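/- For every prime p, the elementary abelian group R = (ℤ/pℤ)^4 is a DCI-group: for all subsets S, T ⊆ R, if the Cayley digraphs Cay(R,S) and Cay(R,T) are isomorphic, then there exists a group automorphism φ of R with φ(S) = T. -/

import Mathlib

namespace DCI

variable {p : ℕ} [Fact p.Prime] {V : Type*} [AddCommGroup V] [Module (ZMod p) V]

/-- A subset closed under addition and containing zero is a `ZMod p`-submodule. -/
def mkSub (s : Set V) (h0 : (0 : V) ∈ s) (hadd : ∀ x y, x ∈ s → y ∈ s → x + y ∈ s) :
    Submodule (ZMod p) V where
  carrier := s
  zero_mem' := h0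
  add_mem' := fun {a b} ha hb => hadd a b ha hb
  smul_mem' := by
    intro c x hx
    have h : ∀ n : ℕ, n • x ∈ s := by
      intro n
      induction n with
      | zero => simpa using h0
      | succ n ih => rw [succ_nsmul]; exact hadd _ _ ih hx
    have h2 : c • x = c.val • x := by
      conv_lhs => rw [← ZMod.natCast_zmod_val c]
      rw [Nat.cast_smul_eq_nsmul]
    rw [h2]; exact h _

@[simp] theorem mem_mkSub (s : Set V) (h0) (hadd) (x : V) :
    x ∈ (mkSub s h0 hadd : Submodule (ZMod p) V) ↔ x ∈ s := Iff.rfl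

/-- translation -/
def tr (v : V) : Equiv.Perm V := Equiv.addLeft v

@[simp] theorem tr_apply (v x : V) : tr v x = v + x := rfl

/-- translation of the second structure -/
def om (f : Equiv.Perm V) (w : V) : Equiv.Perm V := f * Equiv.addLeft w * f⁻¹

@[simp] theorem om_apply (f : Equiv.Perm V) (w x : V) : om f w x = f (w + f.symm x) := rfl

variable (f : Equiv.Perm V)

/-- the group generated by both kinds of translations by elements of `P` -/
def GG (P : Submodule (ZMod p) V) : Subgroup (Equiv.Perm V) :=
  Subgroup.closure ({g | ∃ v ∈ P, g = tr v} ∪ {g | ∃ w, f w ∈ P ∧ g = om f w})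

/-- the point stabilizer -/
def Hs (P : Submodule (ZMod p) V) : Subgroup (Equiv.Perm V) :=
  GG f P ⊓ MulAction.stabilizer (Equiv.Perm V) (0 : V)

variable {f}

theorem mem_Hs {P : Submodule (ZMod p) V} {h : Equiv.Perm V} :
    h ∈ Hs f P ↔ h ∈ GG f P ∧ h 0 = 0 := by
  simp [Hs, Subgroup.mem_inf, MulAction.mem_stabilizer_iff]

theorem tr_mem {P : Submodule (ZMod p) V} {v : V} (hv : v ∈ P) : tr v ∈ GG f P :=
  Subgroup.subset_closure (Or.inl ⟨v, hv, rfl⟩)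

theorem om_mem {P : Submodule (ZMod p) V} {w : V} (hw : f w ∈ P) : om f w ∈ GG f P :=
  Subgroup.subset_closure (Or.inr ⟨w, hw, rfl⟩)

theorem GG_mono {M P : Submodule (ZMod p) V} (h : M ≤ P) : GG f M ≤ GG f P := by
  apply Subgroup.closure_mono
  rintro g (⟨v, hv, rfl⟩ | ⟨w, hw, rfl⟩)
  · exact Or.inl ⟨v, h hv, rfl⟩
  · exact Or.inr ⟨w, h hw, rfl⟩

theorem Hs_mono {M P : Submodule (ZMod p) V} (h : M ≤ P) : Hs f M ≤ Hs f P :=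
  inf_le_inf_right _ (GG_mono h)

/-- `P` is also a subspace for the second structure -/
structure Cl (f : Equiv.Perm V) (P : Submodule (ZMod p) V) : Prop where
  zero : f 0 = 0
  add : ∀ w w', f w ∈ P → f w' ∈ P → f (w + w') ∈ P

theorem Cl.pull {P : Submodule (ZMod p) V} (h : Cl f P) :
    ∃ PW : Submodule (ZMod p) V, ∀ w, w ∈ PW ↔ f w ∈ P :=
  ⟨mkSub {w | f w ∈ P} (by simp [h.zero]) (fun x y hx hy => h.add x y hx hy), fun w => Iff.rfl⟩

theorem Cl.neg {P : Submodule (ZMod p) V} (h : Cl f P) {w : V} (hw : f w ∈ P) : f (-w) ∈ P := by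
  obtain ⟨PW, hP⟩ := h.pull
  rw [← hP] at hw ⊢
  exact PW.neg_mem hw

theorem Cl.pres' {P : Submodule (ZMod p) V} (h : Cl f P) {g : Equiv.Perm V} (hg : g ∈ GG f P) :
    ∀ x, g x ∈ P ↔ x ∈ P := by
  refine Subgroup.closure_induction (p := fun g _ => ∀ x, g x ∈ P ↔ x ∈ P) ?_ ?_ ?_ ?_ hg
  · rintro g (⟨v, hv, rfl⟩ | ⟨w, hw, rfl⟩) x
    · simpa using P.add_mem_iff_right hv
    · simp only [om_apply]
      constructor
      · intro hx
        have := h.add _ _ (h.neg hw) hx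
        simpa using this
      · intro hx
        exact h.add _ _ hw (by simpa using hx)
  · intro x; simp
  · intro a b _ _ ha hb x
    rw [Equiv.Perm.mul_apply, ha, hb]
  · intro a _ ha x
    rw [← ha]; simp

theorem Cl.pres {P : Submodule (ZMod p) V} (h : Cl f P) {g : Equiv.Perm V} (hg : g ∈ GG f P)
    {x : V} (hx : x ∈ P) : g x ∈ P := (h.pres' hg x).2 hx

theorem Cl.presH {P : Submodule (ZMod p) V} (h : Cl f P) {g : Equiv.Perm V} (hg : g ∈ Hs f P)
    {x : V} (hx : x ∈ P) : g x ∈ P := h.pres (mem_Hs.1 hg).1 hx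

theorem Cl.delta {P : Submodule (ZMod p) V} (h : Cl f P) {g : Equiv.Perm V} (hg : g ∈ GG f P)
    {u : V} (hu : u ∈ P) : tr (-(g u)) * g * tr u ∈ Hs f P := by
  rw [mem_Hs]
  refine ⟨mul_mem (mul_mem (tr_mem (P.neg_mem (h.pres hg hu))) hg) (tr_mem hu), by simp⟩

/-- basic situation: `Y ≤ P` are both invariant -/
structure Sys (f : Equiv.Perm V) (Y P : Submodule (ZMod p) V) : Prop where
  cl : Cl f P
  le : Y ≤ P
  inv : ∀ h ∈ Hs f P, ∀ y ∈ Y, h y ∈ Y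

variable {Y Z P M : Submodule (ZMod p) V}

theorem Sys.block (s : Sys f Y P) {g : Equiv.Perm V} (hg : g ∈ GG f P) {x y : V} (hx : x ∈ P)
    (hy : y ∈ Y) : g (x + y) - g x ∈ Y := by
  have := s.inv _ (s.cl.delta hg hx) y hy
  simpa [sub_eq_neg_add] using this

/-- variant of the block property -/
theorem Sys.block' (s : Sys f Y P) {g : Equiv.Perm V} (hg : g ∈ GG f P) {x y : V} (hx : x ∈ P)
    (hy : y - x ∈ Y) : g y - g x ∈ Y := by
  have := s.block hg hx hy
  simpa using this

theorem Sys.om_sub (s : Sys f Y P) {w x y : V} (hw : f w ∈ P) (hx : f x ∈ P)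
    (hy : f y - f x ∈ Y) : f (w + y) - f (w + x) ∈ Y := by
  simpa using s.block' (om_mem hw) hx hy

theorem Sys.f_sub (s : Sys f Y P) {x y : V} (hx : f x ∈ P)
    (hy : f y - f x ∈ Y) : f (y - x) ∈ Y := by
  have := s.om_sub (s.cl.neg hx) hx hy
  simpa [s.cl.zero, sub_eq_neg_add] using this

theorem Sys.clY (s : Sys f Y P) : Cl f Y := by
  refine ⟨s.cl.zero, fun w w' hw hw' => ?_⟩
  have := s.om_sub (w := w) (x := 0) (y := w') (s.le hw) (by simp [s.cl.zero])
    (by simpa [s.cl.zero] using hw')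
  simpa using Y.add_mem this hw

theorem Sys.sub (s : Sys f Y P) (m : Sys f M P) (hY : Y ≤ M) : Sys f Y M :=
  ⟨m.clY, hY, fun h hh y hy => s.inv h (Hs_mono m.le hh) y hy⟩

/-- Points of `P` fixed modulo `Y` by all `h` acting trivially modulo `Z`. -/
def Fx (f : Equiv.Perm V) (hc : Cl f P) (Z Y : Submodule (ZMod p) V) : Submodule (ZMod p) V :=
  mkSub {u | u ∈ P ∧ ∀ h ∈ Hs f P, (∀ x ∈ P, h x - x ∈ Z) → h u - u ∈ Y}
    ⟨P.zero_mem, fun h hh _ => by simp [(mem_Hs.1 hh).2]⟩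
    (by
      rintro x y ⟨hx, hx'⟩ ⟨hy, hy'⟩
      refine ⟨P.add_mem hx hy, fun h hh hz => ?_⟩
      have h1 := hx' h hh hz
      have h2 := hy' _ (hc.delta (mem_Hs.1 hh).1 hx) (fun t ht => by
        have := Z.sub_mem (hz _ (P.add_mem hx ht)) (hz _ hx)
        simp only [Equiv.Perm.mul_apply, tr_apply]
        convert this using 1; abel)
      simp only [Equiv.Perm.mul_apply, tr_apply] at h2
      convert Y.add_mem h1 h2 using 1; abel)

theorem mem_Fx (hc : Cl f P) {u : V} : u ∈ Fx f hc Z Y ↔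
    u ∈ P ∧ ∀ h ∈ Hs f P, (∀ x ∈ P, h x - x ∈ Z) → h u - u ∈ Y := Iff.rfl

theorem Sys.Fx (s : Sys f Y P) (t : Sys f Z P) : Sys f (Fx f s.cl Z Y) P := by
  refine ⟨s.cl, fun x hx => hx.1, fun h hh y hy => ?_⟩
  rw [mem_Fx] at hy ⊢
  refine ⟨s.cl.presH hh hy.1, fun k hk hkz => ?_⟩
  have hm : h⁻¹ * k * h ∈ Hs f P := mul_mem (mul_mem (inv_mem hh) hk) hh
  have h1 := hy.2 _ hm (fun x hx => by
    have h2 := t.block' (mem_Hs.1 (inv_mem hh)).1 (s.cl.presH hh hx) (hkz _ (s.cl.presH hh hx))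
    simpa using h2)
  have h3 := s.block' (mem_Hs.1 hh).1 hy.1 h1
  simpa using h3

theorem Sys.le_Fx (s : Sys f Y P) : Y ≤ DCI.Fx f s.cl Z Y := fun y hy =>
  ⟨s.le hy, fun h hh _ => Y.sub_mem (s.inv h hh y hy) hy⟩

/-- central elements modulo `Y` -/
def Sys.Cen (s : Sys f Y P) : Submodule (ZMod p) V := DCI.Fx f s.cl ⊤ Y

theorem Sys.mem_Cen (s : Sys f Y P) {u : V} :
    u ∈ s.Cen ↔ u ∈ P ∧ ∀ h ∈ Hs f P, h u - u ∈ Y := by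
  simp [Sys.Cen, mem_Fx]

theorem Sys.le_Cen (s : Sys f Y P) : Y ≤ s.Cen := s.le_Fx

theorem Sys.Cen_le (s : Sys f Y P) : s.Cen ≤ P := fun _ h => h.1

theorem Sys.sysZ (s : Sys f Y P) (h1 : Y ≤ Z) (h2 : Z ≤ s.Cen) : Sys f Z P :=
  ⟨s.cl, h2.trans s.Cen_le, fun h hh z hz => by
    have := Z.add_mem (h1 ((s.mem_Cen.1 (h2 hz)).2 h hh)) hz
    simpa using this⟩

theorem Sys.Cen_le_Fx (s : Sys f Y P) : s.Cen ≤ DCI.Fx f s.cl Z Y := fun _ hu =>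
  ⟨hu.1, fun h hh _ => (s.mem_Cen.1 hu).2 h hh⟩

theorem Sys.cen_add (s : Sys f Y P) {z x : V} (hz : z ∈ s.Cen) (hx : x ∈ P) {g : Equiv.Perm V}
    (hg : g ∈ GG f P) : g (x + z) - g x - z ∈ Y := by
  have := (s.mem_Cen.1 hz).2 _ (s.cl.delta hg hx)
  simpa [sub_eq_neg_add] using this

theorem Sys.cen_f (s : Sys f Y P) {w z : V} (hw : f w ∈ P) (hz : f z ∈ s.Cen) :
    f (w + z) - f w - f z ∈ Y := by
  have := s.cen_add (x := 0) hz P.zero_mem (om_mem hw)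
  have h0 : f.symm 0 = 0 := by rw [Equiv.symm_apply_eq, s.cl.zero]
  simpa [h0] using this

theorem Sys.common (s : Sys f Y P) {v : V} (hv : v ∈ P)
    (h : ∀ x ∈ P, f (f.symm v + f.symm x) - x - v ∈ Y) : v ∈ s.Cen := by
  rw [s.mem_Cen]
  refine ⟨hv, fun k hk => ?_⟩
  have key : ∀ x ∈ P, k (x + v) - k x - v ∈ Y := by
    refine (Subgroup.closure_induction
      (p := fun g _ => ∀ x ∈ P, g (x + v) - g x - v ∈ Y) ?_ ?_ ?_ ?_ (mem_Hs.1 hk).1)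
    · rintro g (⟨u, hu, rfl⟩ | ⟨w, hw, rfl⟩) x hx
      · simp [← add_assoc]
      · have h1 := s.block' (om_mem hw) (P.add_mem hx hv) (y := f (f.symm v + f.symm x))
          (by simpa [sub_sub] using h x hx)
        have h2 := h _ (s.cl.pres (om_mem hw) hx)
        simp only [om_apply, Equiv.symm_apply_apply] at h1 h2 ⊢
        rw [add_left_comm] at h2
        convert Y.sub_mem h2 h1 using 1; abel
    · intro x hx; simp
    · intro a b ha hb iha ihb x hx
      have h1 := ihb x hx
      have hbx := s.cl.pres hb hx
      have h2 := s.block' ha (P.add_mem hbx hv) (y := b (x + v)) (by simpa [sub_sub] using h1)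
      have h3 := iha _ hbx
      simp only [Equiv.Perm.mul_apply]
      convert Y.add_mem h2 h3 using 1; abel
    · intro a ha iha x hx
      have hx' := s.cl.pres (inv_mem ha) hx
      have h1 := iha _ hx'
      have h2 := s.block' (inv_mem ha) (x := x + v) (y := a (a⁻¹ x + v)) (P.add_mem hx hv)
        (by simpa [sub_sub] using h1)
      have h3 := Y.neg_mem h2
      have e : a⁻¹ (a (a⁻¹ x + v)) = a⁻¹ x + v := a.symm_apply_apply _
      rw [e] at h3
      convert h3 using 1; abel
  simpa [(mem_Hs.1 hk).2] using key 0 P.zero_mem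

theorem Sys.topM (s : Sys f Y P) (t : Sys f Z P) (h : P ≤ DCI.Fx f s.cl Z Y) :
    t.Cen ≤ s.Cen := by
  intro v hv
  have hvP := t.Cen_le hv
  have hfv : f (f.symm v) ∈ P := by simpa using hvP
  apply s.common hvP
  have h0 : f.symm 0 = 0 := by rw [Equiv.symm_apply_eq, s.cl.zero]
  intro x hx
  have := (mem_Fx s.cl).1 (h hx)
  have h2 := this.2 _ (s.cl.delta (om_mem hfv) P.zero_mem) (fun y hy => by
    have := t.cen_f (w := f.symm y) (z := f.symm v) (by simpa using hy) (by simpa using hv)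
    rw [add_comm] at this
    simp only [Equiv.Perm.mul_apply, tr_apply, om_apply, h0, Equiv.apply_symm_apply, add_zero,
      zero_add] at this ⊢
    convert this using 1; abel)
  simp only [Equiv.Perm.mul_apply, tr_apply, om_apply, h0, Equiv.apply_symm_apply, add_zero,
      zero_add] at h2
  convert h2 using 1; abel

end DCI

namespace DCI

variable {p : ℕ} [Fact p.Prime] {V : Type*} [AddCommGroup V] [Module (ZMod p) V]
variable {f : Equiv.Perm V} {Y Z P M : Submodule (ZMod p) V}

/-- the action of the stabilizer on `M / Y` -/
@[reducible] def Sys.act (s : Sys f Y P) (m : Sys f M P) :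
    MulAction (Hs f P) (M ⧸ Y.submoduleOf M) where
  smul h := Quotient.map'
    (fun x : M => (⟨h.1 x, m.inv _ h.2 _ x.2⟩ : M)) (by
      intro a b hab
      rw [Submodule.quotientRel_def, Submodule.submoduleOf, Submodule.mem_comap] at hab ⊢
      exact s.block' (mem_Hs.1 h.2).1 (m.le b.2) hab)
  one_smul q := by
    induction q using Quotient.inductionOn'
    rfl
  mul_smul a b q := by
    induction q using Quotient.inductionOn'
    rfl

open Module

section fin

variable [Finite V]

theorem Sys.exists_cen' (hG : IsPGroup p (GG f (⊤ : Submodule (ZMod p) V))) (s : Sys f Y P)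
    (m : Sys f M P) (hle : Y ≤ M) (hne : Y ≠ M) : ∃ v ∈ s.Cen, v ∈ M ∧ v ∉ Y := by
  have hH : IsPGroup p (Hs f P) := hG.to_le (inf_le_left.trans (GG_mono le_top))
  let _ := s.act m
  have hfin : Finite (M ⧸ Y.submoduleOf M) :=
    Finite.of_surjective _ (Submodule.Quotient.mk_surjective _)
  have hsm : ∀ (h : Hs f P) (x : M), h • (Submodule.Quotient.mk x : M ⧸ Y.submoduleOf M)
      = Submodule.Quotient.mk (⟨h.1 x, m.inv _ h.2 _ x.2⟩ : M) := fun h x => rfl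
  have hnt : Nontrivial (M ⧸ Y.submoduleOf M) := by
    rw [Submodule.Quotient.nontrivial_iff]
    intro h
    exact hne (le_antisymm hle (Submodule.submoduleOf_eq_top.1 h))
  have hdvd : p ∣ Nat.card (M ⧸ Y.submoduleOf M) := by
    rw [Module.natCard_eq_pow_finrank (K := ZMod p)]
    simp only [Nat.card_zmod]
    exact dvd_pow_self _ (Module.finrank_pos).ne'
  obtain ⟨b, hb, hb0⟩ := hH.exists_fixed_point_of_prime_dvd_card_of_fixed_point
    (M ⧸ Y.submoduleOf M) hdvd (a := Submodule.Quotient.mk 0) (by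
      intro h
      rw [hsm]
      congr 1
      ext
      simpa using (mem_Hs.1 h.2).2)
  obtain ⟨v, rfl⟩ := Submodule.Quotient.mk_surjective _ b
  refine ⟨v, ?_, v.2, ?_⟩
  · rw [s.mem_Cen]
    refine ⟨m.le v.2, fun h hh => ?_⟩
    have := hb ⟨h, hh⟩
    rw [hsm, Submodule.Quotient.eq] at this
    exact this
  · intro hv
    apply hb0
    rw [eq_comm, Submodule.Quotient.eq]
    simpa [Submodule.submoduleOf] using hv

theorem Sys.self (s : Sys f Y P) : Sys f P P := ⟨s.cl, le_rfl, fun _ hh _ hy => s.cl.presH hh hy⟩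

theorem Sys.exists_cen (hG : IsPGroup p (GG f (⊤ : Submodule (ZMod p) V))) (s : Sys f Y P)
    (hne : Y ≠ P) : ∃ v ∈ s.Cen, v ∉ Y := by
  obtain ⟨v, h1, _, h2⟩ := s.exists_cen' hG s.self s.le hne
  exact ⟨v, h1, h2⟩

theorem Sys.cod1' (hG : IsPGroup p (GG f (⊤ : Submodule (ZMod p) V))) (s : Sys f Y P)
    (m : Sys f M P) (hle : Y ≤ M)
    (h : finrank (ZMod p) M ≤ finrank (ZMod p) Y + 1) : M ≤ s.Cen := by
  by_cases hne : Y = M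
  · exact hne.symm.le.trans s.le_Cen
  obtain ⟨v, hv, hvM, hvY⟩ := s.exists_cen' hG m hle hne
  have h1 : finrank (ZMod p) Y < finrank (ZMod p) (s.Cen ⊓ M : Submodule (ZMod p) V) := by
    apply Submodule.finrank_lt_finrank_of_lt
    refine lt_of_le_of_ne (le_inf s.le_Cen hle) (fun e => hvY ?_)
    rw [e]; exact ⟨hv, hvM⟩
  have := (Submodule.eq_of_le_of_finrank_le (inf_le_right : s.Cen ⊓ M ≤ M) (by omega)).ge
  exact this.trans inf_le_left

theorem Sys.cod1 (hG : IsPGroup p (GG f (⊤ : Submodule (ZMod p) V))) (s : Sys f Y P)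
    (h : finrank (ZMod p) P ≤ finrank (ZMod p) Y + 1) : P ≤ s.Cen := s.cod1' hG s.self s.le h

end fin

/-- the shifts of `u` by elements of `Z` realized modulo `Y`. -/
def Sys.D (s : Sys f Y P) (hZ : Z ≤ s.Cen) (_hYZ : Y ≤ Z) (u : V) (hu : u ∈ P) :
    Submodule (ZMod p) V :=
  mkSub {z | z ∈ Z ∧ ∃ h ∈ Hs f P, (∀ x ∈ P, h x - x ∈ Z) ∧ h u - u - z ∈ Y}
    ⟨Z.zero_mem, 1, one_mem _, by simp, by simp⟩
    (by
      rintro a b ⟨ha, h, hh, hhZ, hu1⟩ ⟨hb, k, hk, hkZ, hu2⟩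
      refine ⟨Z.add_mem ha hb, h * k, mul_mem hh hk, fun x hx => ?_, ?_⟩
      · convert Z.add_mem (hhZ _ (s.cl.presH hk hx)) (hkZ _ hx) using 1
        simp
      · have hbP : b ∈ P := s.Cen_le (hZ hb)
        have h1 := s.cen_add (hZ hb) hu (mem_Hs.1 hh).1
        have h2 := s.block' (mem_Hs.1 hh).1 (P.add_mem hu hbP) (y := k u)
          (by simpa [sub_sub] using hu2)
        convert Y.add_mem (Y.add_mem h1 h2) hu1 using 1
        simp only [Equiv.Perm.mul_apply]
        abel)

theorem Sys.mem_D (s : Sys f Y P) {hZ : Z ≤ s.Cen} {hYZ : Y ≤ Z} {u : V} {hu : u ∈ P} {z : V} :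
    z ∈ s.D hZ hYZ u hu ↔
      z ∈ Z ∧ ∃ h ∈ Hs f P, (∀ x ∈ P, h x - x ∈ Z) ∧ h u - u - z ∈ Y := Iff.rfl

theorem Sys.le_D (s : Sys f Y P) {hZ : Z ≤ s.Cen} {hYZ : Y ≤ Z} {u : V} {hu : u ∈ P} :
    Y ≤ s.D hZ hYZ u hu := fun y hy =>
  ⟨hYZ hy, 1, one_mem _, by simp, by simpa using hy⟩

theorem Sys.D_le (s : Sys f Y P) {hZ : Z ≤ s.Cen} {hYZ : Y ≤ Z} {u : V} {hu : u ∈ P} :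
    s.D hZ hYZ u hu ≤ Z := fun _ hy => hy.1

theorem Sys.sub_mem_D (s : Sys f Y P) {hZ : Z ≤ s.Cen} {hYZ : Y ≤ Z} {u : V} {hu : u ∈ P}
    {h : Equiv.Perm V} (hh : h ∈ Hs f P) (hhZ : ∀ x ∈ P, h x - x ∈ Z) :
    h u - u ∈ s.D hZ hYZ u hu := ⟨hhZ _ hu, h, hh, hhZ, by simp⟩

/-- all shifts by `Z` are realized modulo `Y` -/
def Fill (f : Equiv.Perm V) (P Z Y : Submodule (ZMod p) V) (u : V) : Prop :=
  ∀ z ∈ Z, ∃ h ∈ Hs f P, h u - u - z ∈ Y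

theorem Sys.fill [Finite V] (s : Sys f Y P) (hZ : Z ≤ s.Cen) (hYZ : Y ≤ Z)
    (hfr : finrank (ZMod p) Z ≤ finrank (ZMod p) Y + 1) {u : V} (hu : u ∈ P)
    (hu' : u ∉ DCI.Fx f s.cl Z Y) : Fill f P Z Y u := by
  have hne : Y ≠ s.D hZ hYZ u hu := by
    intro e
    apply hu'
    rw [mem_Fx]
    refine ⟨hu, fun h hh hhZ => ?_⟩
    rw [e]
    exact s.sub_mem_D hh hhZ
  have h1 := Submodule.finrank_lt_finrank_of_lt (lt_of_le_of_ne s.le_D hne)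
  have h2 : s.D hZ hYZ u hu = Z := Submodule.eq_of_le_of_finrank_le s.D_le (by omega)
  intro z hz
  rw [← h2] at hz
  obtain ⟨_, h, hh, _, h3⟩ := hz
  exact ⟨h, hh, h3⟩

def Good (f : Equiv.Perm V) (P Y : Submodule (ZMod p) V) (φ : V →ₗ[ZMod p] V) (u : V) : Prop :=
  ∃ h ∈ Hs f P, f (φ u) - h u ∈ Y

def TG (f : Equiv.Perm V) (Y P : Submodule (ZMod p) V) : Prop :=
  ∃ φ : V →ₗ[ZMod p] V, ∀ u ∈ P, Good f P Y φ u

theorem Good.mono {φ : V →ₗ[ZMod p] V} {u : V} (h : Good f M Y φ u) (hMP : M ≤ P) (hYZ : Y ≤ Z) :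
    Good f P Z φ u := by
  obtain ⟨k, hk, hk'⟩ := h
  exact ⟨k, Hs_mono hMP hk, hYZ hk'⟩

theorem Sys.good_mem (s : Sys f Y P) {φ : V →ₗ[ZMod p] V} {u : V} (h : Good f P Y φ u)
    (hu : u ∈ P) : f (φ u) ∈ P := by
  obtain ⟨k, hk, hk'⟩ := h
  simpa using P.add_mem (s.le hk') (s.cl.presH hk hu)

/-- goodness modulo `Z` plus filling gives goodness modulo `Y` -/
theorem Sys.good_of_fill (s : Sys f Y P) (hZ : Z ≤ s.Cen) {φ : V →ₗ[ZMod p] V}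
    {u : V} (hu : u ∈ P) (hF : Fill f P Z Y u) (h : Good f P Z φ u) : Good f P Y φ u := by
  obtain ⟨k, hk, hk'⟩ := h
  obtain ⟨m, hm, hm'⟩ := hF _ hk'
  refine ⟨k * m, mul_mem hk hm, ?_⟩
  have h1 := s.cen_add (hZ hk') hu (mem_Hs.1 hk).1
  have h2 := s.block' (mem_Hs.1 hk).1 (P.add_mem hu (s.Cen_le (hZ hk'))) (y := m u)
    (by simpa [sub_sub] using hm')
  convert Y.neg_mem (Y.add_mem h1 h2) using 1
  simp only [Equiv.Perm.mul_apply]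
  abel

/-- changing a good map by something landing in `Z` -/
theorem Sys.good_shift (s : Sys f Y P) (hYZ : Y ≤ Z) (hZ : Z ≤ s.Cen) {φ φ' : V →ₗ[ZMod p] V}
    {u : V} (hu : u ∈ P) (h : Good f P Z φ u) (h' : f (φ' u - φ u) ∈ Z) : Good f P Z φ' u := by
  have t := s.sysZ hYZ hZ
  have h1 := s.cen_f (t.good_mem h hu) (hZ h')
  obtain ⟨k, hk, hk'⟩ := h
  refine ⟨k, hk, ?_⟩
  rw [add_sub_cancel] at h1
  convert Z.add_mem (Z.add_mem (hYZ h1) h') hk' using 1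
  abel

theorem Sys.good_shift' (s : Sys f Y P) {φ φ' : V →ₗ[ZMod p] V}
    {u : V} (hu : u ∈ P) (h : Good f P Y φ u) (hsh : f (φ' u - φ u) ∈ Y) : Good f P Y φ' u :=
  s.good_shift le_rfl s.le_Cen hu h hsh

/-- agreement on central elements -/
theorem Sys.factF (s : Sys f Y P) {φ φ' : V →ₗ[ZMod p] V} {v : V} (hv : v ∈ s.Cen)
    (h : Good f P Y φ v) (h' : Good f P Y φ' v) : f (φ' v - φ v) ∈ Y := by
  have h0 := s.good_mem h (s.Cen_le hv)
  obtain ⟨k, hk, hk'⟩ := h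
  obtain ⟨m, hm, hm'⟩ := h'
  apply s.f_sub h0
  have h1 := (s.mem_Cen.1 hv).2 _ hk
  have h2 := (s.mem_Cen.1 hv).2 _ hm
  convert Y.sub_mem (Y.add_mem hm' h2) (Y.add_mem hk' h1) using 1
  abel

/-- linear maps with values in a submodule extend -/
theorem exists_ext {M : Submodule (ZMod p) V} (Q : Submodule (ZMod p) V) (μ : V →ₗ[ZMod p] V)
    (h : ∀ u ∈ M, μ u ∈ Q) : ∃ l : V →ₗ[ZMod p] V, (∀ u, l u ∈ Q) ∧ ∀ u ∈ M, l u = μ u := by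
  obtain ⟨g, hg⟩ := LinearMap.exists_extend
    ((μ.comp M.subtype).codRestrict Q (fun u => h u.1 u.2))
  refine ⟨Q.subtype.comp g, fun u => (g u).2, fun u hu => ?_⟩
  exact congrArg (fun l => (l ⟨u, hu⟩ : V)) hg

theorem Sys.glue (s : Sys f Y P) (hYZ : Y ≤ Z) (hZ : Z ≤ s.Cen)
    (hF : ∀ u ∈ P, u ∉ M → Fill f P Z Y u) (φ₀ φ₁ : V →ₗ[ZMod p] V)
    (h₀ : ∀ u ∈ P, Good f P Z φ₀ u) (h₁ : ∀ u ∈ M, Good f P Y φ₁ u)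
    (h : ∀ u ∈ M, f (φ₁ u - φ₀ u) ∈ Z) : TG f Y P := by
  have t := s.sysZ hYZ hZ
  obtain ⟨ZW, hZW⟩ := t.clY.pull
  obtain ⟨l, hl, hl'⟩ := exists_ext (M := M) ZW (φ₁ - φ₀) (fun u hu => by
    rw [hZW]; exact h u hu)
  refine ⟨φ₀ + l, fun u hu => ?_⟩
  by_cases hM : u ∈ M
  · obtain ⟨k, hk, hk'⟩ := h₁ u hM
    refine ⟨k, hk, ?_⟩
    rw [LinearMap.add_apply, hl' u hM]
    simpa using hk'
  · apply s.good_of_fill hZ hu (hF u hu hM)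
    apply s.good_shift hYZ hZ hu (h₀ u hu)
    rw [← hZW]
    simpa using hl u

theorem Sys.lin (s : Sys f Y P) : ∃ φ : V →ₗ[ZMod p] V, ∀ u ∈ s.Cen, f (φ u) - u ∈ Y := by
  have t := s.sysZ s.le_Cen le_rfl
  obtain ⟨XW, hXW⟩ := t.clY.pull
  let π : XW →ₗ[ZMod p] V ⧸ Y := AddMonoidHom.toZModLinearMap p
    { toFun := fun w => Y.mkQ (f w)
      map_zero' := by simp [s.cl.zero]
      map_add' := by
        intro a b
        rw [← map_add, ← sub_eq_zero, ← map_sub, Submodule.mkQ_apply,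
          Submodule.Quotient.mk_eq_zero]
        have := s.cen_f (s.Cen_le ((hXW a).1 a.2)) ((hXW b).1 b.2)
        simpa [sub_sub] using this }
  have hπ : ∀ w, π w = Y.mkQ (f w) := fun w => rfl
  obtain ⟨g, hg⟩ := LinearMap.exists_rightInverse_of_surjective π.rangeRestrict
    (LinearMap.range_rangeRestrict π)
  let a : s.Cen →ₗ[ZMod p] LinearMap.range π := (Y.mkQ.comp s.Cen.subtype).codRestrict _ (by
    intro c
    refine ⟨⟨f.symm c, by rw [hXW]; simp⟩, ?_⟩
    rw [hπ]; simp)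
  obtain ⟨φ, hφ⟩ := LinearMap.exists_extend (XW.subtype.comp (g.comp a))
  refine ⟨φ, fun u hu => ?_⟩
  have h1 : φ u = g (a ⟨u, hu⟩) := by
    have := LinearMap.congr_fun hφ ⟨u, hu⟩
    simpa using this
  have h2 : π (g (a ⟨u, hu⟩)) = Y.mkQ u := by
    have := LinearMap.congr_fun hg (a ⟨u, hu⟩)
    exact congrArg Subtype.val this
  rw [hπ, ← h1, ← sub_eq_zero, ← map_sub, Submodule.mkQ_apply,
          Submodule.Quotient.mk_eq_zero] at h2
  exact h2

/-- a subspace of codimension at most one and a vector outside it -/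
theorem decomp [Finite V] {X : Submodule (ZMod p) V} (hX : X ≤ P)
    (hfr : finrank (ZMod p) P ≤ finrank (ZMod p) X + 1) {v : V} (hv : v ∈ P) (hvX : v ∉ X) {u : V}
    (hu : u ∈ P) : ∃ n : ℕ, ∃ x ∈ X, u = x + n • v := by
  have hle : X ⊔ Submodule.span (ZMod p) {v} ≤ P :=
    sup_le hX (by simpa using hv)
  have hlt : X < X ⊔ Submodule.span (ZMod p) {v} := by
    refine lt_of_le_of_ne le_sup_left (fun e => hvX ?_)
    rw [e]
    exact Submodule.mem_sup_right (Submodule.mem_span_singleton_self v)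
  have h1 := Submodule.finrank_lt_finrank_of_lt hlt
  have h2 := Submodule.eq_of_le_of_finrank_le hle (by omega)
  rw [← h2, Submodule.mem_sup] at hu
  obtain ⟨x, hx, y, hy, rfl⟩ := hu
  obtain ⟨c, rfl⟩ := Submodule.mem_span_singleton.1 hy
  refine ⟨c.val, x, hx, ?_⟩
  congr 1
  conv_lhs => rw [← ZMod.natCast_zmod_val c]
  rw [Nat.cast_smul_eq_nsmul]

end DCI

namespace DCI

variable {p : ℕ} [Fact p.Prime] {V : Type*} [AddCommGroup V] [Module (ZMod p) V]
variable {f : Equiv.Perm V} {Y Z P M : Submodule (ZMod p) V}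
open Module

section fin

variable [Finite V]

theorem Sys.codim (hG : IsPGroup p (GG f (⊤ : Submodule (ZMod p) V))) (s : Sys f Y P)
    (hfr : finrank (ZMod p) P ≤ finrank (ZMod p) s.Cen + 1) : TG f Y P := by
  obtain ⟨φX, hφX⟩ := s.lin
  by_cases hP : P ≤ s.Cen
  · exact ⟨φX, fun u hu => ⟨1, one_mem _, by simpa using hφX u (hP hu)⟩⟩
  obtain ⟨v, hv, hvX⟩ := SetLike.not_le_iff_exists.1 hP
  have t := s.sysZ s.le_Cen le_rfl
  have hc := t.cod1 hG hfr
  obtain ⟨φ, hφ1, hφ2⟩ := LinearMap.exists_extend_of_notMem (φX.comp s.Cen.subtype) hvX (f.symm v)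
  have hφx : ∀ x ∈ s.Cen, φ x = φX x := fun x hx => LinearMap.congr_fun hφ1 ⟨x, hx⟩
  refine ⟨φ, fun u hu => ?_⟩
  by_cases hux : u ∈ s.Cen
  · refine ⟨1, one_mem _, ?_⟩
    rw [hφx u hux]
    exact hφX u hux
  obtain ⟨n, x, hx, hunx⟩ := decomp s.Cen_le hfr hv hvX hu
  have hall : ∀ h ∈ Hs f P, ∀ x ∈ P, h x - x ∈ s.Cen := fun h hh x hx =>
    (t.mem_Cen.1 (hc hx)).2 h hh
  have h0 : f.symm 0 = 0 := by rw [Equiv.symm_apply_eq, s.cl.zero]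
  set D := s.D le_rfl s.le_Cen u hu with hD
  have c1 : ∀ h ∈ Hs f P, ∀ x ∈ P, h (x + u) - h x - u ∈ D := by
    intro h hh x hx
    have hd := s.cl.delta (mem_Hs.1 hh).1 hx
    have := s.sub_mem_D (hZ := le_rfl) (hYZ := s.le_Cen) (hu := hu) hd (hall _ hd)
    simp only [Equiv.Perm.mul_apply, tr_apply] at this
    convert this using 1; abel
  have c2 : ∀ h ∈ Hs f P, ∀ m : ℕ, h (m • u) - m • u ∈ D := by
    intro h hh m
    induction m with
    | zero => simp [(mem_Hs.1 hh).2]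
    | succ m ih =>
      have := c1 h hh (m • u) (P.smul_of_tower_mem m hu)
      rw [succ_nsmul]
      convert D.add_mem this ih using 1; abel
  have c3 : ∀ h ∈ Hs f P, ∀ y ∈ P, h y - y ∈ D := by
    intro h hh y hy
    obtain ⟨m, x', hx', rfl⟩ := decomp s.Cen_le hfr hu hux hy
    have h1 := s.cen_add hx' (P.smul_of_tower_mem m hu) (mem_Hs.1 hh).1
    have h2 := D.add_mem (s.le_D h1) (c2 h hh m)
    convert h2 using 1
    rw [add_comm x']; abel
  have hfv : f (f.symm v) ∈ P := by simpa using hv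
  have hk := s.cl.delta (om_mem hfv) P.zero_mem
  have c4 : ∀ m : ℕ, f (m • f.symm v) ∈ P ∧ f (m • f.symm v) - m • v ∈ D := by
    intro m
    induction m with
    | zero => simp [s.cl.zero]
    | succ m ih =>
      have h1 := c3 _ hk _ ih.1
      rw [succ_nsmul', succ_nsmul']
      refine ⟨s.cl.add _ _ hfv ih.1, ?_⟩
      simp only [Equiv.Perm.mul_apply, tr_apply, om_apply, zero_add, h0, add_zero,
        Equiv.apply_symm_apply, Equiv.symm_apply_apply] at h1
      convert D.add_mem h1 ih.2 using 1; abel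
  have h5 : f (φ u) - u ∈ D := by
    have e : φ u = n • f.symm v + φX x := by
      rw [hunx, map_add, map_nsmul, hφ2, hφx x hx, add_comm]
    have h6 := hφX x hx
    have h7 : f (φX x) ∈ s.Cen := by simpa using s.Cen.add_mem (s.le_Cen h6) hx
    have h8 := s.cen_f (c4 n).1 h7
    rw [e]
    convert D.add_mem (D.add_mem (s.le_D h8) (s.le_D h6)) (c4 n).2 using 1
    rw [hunx]; abel
  obtain ⟨_, h, hh, _, h9⟩ := h5
  refine ⟨h, hh, ?_⟩
  convert Y.neg_mem h9 using 1; abel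

theorem Sys.Cen_finrank (hG : IsPGroup p (GG f (⊤ : Submodule (ZMod p) V))) (s : Sys f Y P) :
    P = s.Cen ∨ finrank (ZMod p) Y + 1 ≤ finrank (ZMod p) s.Cen := by
  by_cases h : Y = P
  · left
    exact le_antisymm (h.symm.le.trans s.le_Cen) s.Cen_le
  · right
    obtain ⟨v, hv, hvY⟩ := s.exists_cen hG h
    apply Submodule.finrank_lt_finrank_of_lt
    exact lt_of_le_of_ne s.le_Cen (fun e => hvY (e ▸ hv))

theorem exists_line {X : Submodule (ZMod p) V} (h : Y ≤ X) (hne : Y ≠ X) :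
    ∃ Z, Y ≤ Z ∧ Z ≤ X ∧ finrank (ZMod p) Z = finrank (ZMod p) Y + 1 := by
  obtain ⟨v, hv, hvY⟩ := SetLike.exists_of_lt (lt_of_le_of_ne h hne)
  have hlt : Y < Y ⊔ Submodule.span (ZMod p) {v} := by
    refine lt_of_le_of_ne le_sup_left (fun e => hvY ?_)
    rw [e]
    exact Submodule.mem_sup_right (Submodule.mem_span_singleton_self v)
  refine ⟨Y ⊔ Submodule.span (ZMod p) {v}, le_sup_left, sup_le h (by simpa using hv), ?_⟩
  have h1 := Submodule.finrank_lt_finrank_of_lt hlt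
  have h2 := Submodule.finrank_add_le_finrank_add_finrank Y (Submodule.span (ZMod p) {v})
  have h3 := finrank_span_le_card (R := ZMod p) ({v} : Set V)
  simp at h3
  omega

theorem Sys.T2 (hG : IsPGroup p (GG f (⊤ : Submodule (ZMod p) V))) (s : Sys f Y P)
    (hfr : finrank (ZMod p) P ≤ finrank (ZMod p) Y + 2) : TG f Y P := by
  apply s.codim hG
  rcases s.Cen_finrank hG with h | h
  · rw [← h]; omega
  · omega

/-- if all of `P` is fixed then the center is larger -/
theorem Sys.bigCen (hG : IsPGroup p (GG f (⊤ : Submodule (ZMod p) V))) (s : Sys f Y P)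
    (t : Sys f Z P) (hM : P ≤ DCI.Fx f s.cl Z Y) :
    P = s.Cen ∨ finrank (ZMod p) Z + 1 ≤ finrank (ZMod p) s.Cen := by
  have h1 := s.topM t hM
  rcases t.Cen_finrank hG with h | h
  · left; exact le_antisymm (h.le.trans h1) s.Cen_le
  · right; exact h.trans (Submodule.finrank_mono h1)

theorem Sys.T3 (hG : IsPGroup p (GG f (⊤ : Submodule (ZMod p) V))) (s : Sys f Y P)
    (hfr : finrank (ZMod p) P ≤ finrank (ZMod p) Y + 3) : TG f Y P := by
  by_cases hYP : Y = s.Cen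
  · apply s.T2 hG
    rcases s.Cen_finrank hG with h | h
    · rw [h, ← hYP]; omega
    · rw [← hYP] at h; omega
  obtain ⟨Z, hYZ, hZ, hZr⟩ := exists_line s.le_Cen hYP
  have t := s.sysZ hYZ hZ
  by_cases hM : P ≤ DCI.Fx f s.cl Z Y
  · apply s.codim hG
    rcases s.bigCen hG t hM with h | h
    · rw [← h]; omega
    · omega
  have m := s.Fx t
  have hlt : finrank (ZMod p) (DCI.Fx f s.cl Z Y) < finrank (ZMod p) P :=
    Submodule.finrank_lt_finrank_of_lt (lt_of_le_of_ne m.le (fun e => hM e.ge))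
  obtain ⟨φ₁, h₁⟩ := (s.sub m s.le_Fx).T2 hG (by omega)
  obtain ⟨φ₀, h₀⟩ := t.T2 hG (by omega)
  have hZM : Z ≤ DCI.Fx f s.cl Z Y := hZ.trans s.Cen_le_Fx
  refine s.glue hYZ hZ (fun u hu hu' => s.fill hZ hYZ hZr.le hu hu') φ₀ φ₁ h₀
    (fun u hu => (h₁ u hu).mono m.le le_rfl) (fun u hu => ?_)
  exact t.factF (t.cod1' hG m hZM (by omega) hu) (h₀ u (m.le hu))
    ((h₁ u hu).mono m.le hYZ)

end fin

end DCI

namespace DCI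

variable {p : ℕ} [Fact p.Prime] {V : Type*} [AddCommGroup V] [Module (ZMod p) V]
variable {f : Equiv.Perm V} {Y Z P M : Submodule (ZMod p) V}
open Module

section fin4

variable [Finite V]

/-- linear maps with values in a submodule extend, with a prescribed zero -/
theorem exists_ext0 {M : Submodule (ZMod p) V} (Q : Submodule (ZMod p) V) (μ : V →ₗ[ZMod p] V)
    (h : ∀ u ∈ M, μ u ∈ Q) {e : V} (he : e ∉ M) :
    ∃ l : V →ₗ[ZMod p] V, (∀ u, l u ∈ Q) ∧ (∀ u ∈ M, l u = μ u) ∧ l e = 0 := by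
  obtain ⟨g, hg, hg0⟩ := LinearMap.exists_extend_of_notMem
    ((μ.comp M.subtype).codRestrict Q (fun u => h u.1 u.2)) he 0
  refine ⟨Q.subtype.comp g, fun u => (g u).2, fun u hu => ?_, by simp [hg0]⟩
  exact congrArg (fun l => (l ⟨u, hu⟩ : V)) hg

theorem Sys.ext4 (hG : IsPGroup p (GG f (⊤ : Submodule (ZMod p) V))) (t : Sys f Z P)
    (m : Sys f M P) (hZM : Z ≤ M) (hM2 : finrank (ZMod p) M ≤ finrank (ZMod p) Z + 2)
    (hP1 : finrank (ZMod p) P ≤ finrank (ZMod p) M + 1) (φ₀ φ₁ : V →ₗ[ZMod p] V)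
    (h₀ : ∀ u ∈ P, Good f P Z φ₀ u) (h₁ : ∀ u ∈ M, Good f P Z φ₁ u) :
    ∃ φ : V →ₗ[ZMod p] V, (∀ u ∈ P, Good f P Z φ u) ∧ ∀ u ∈ M, f (φ₁ u - φ u) ∈ Z := by
  by_cases hMC : M ≤ t.Cen
  · exact ⟨φ₀, h₀, fun u hu => t.factF (hMC hu) (h₀ u (m.le hu)) (h₁ u hu)⟩
  have hne : Z ≠ M := fun e => hMC (e ▸ t.le_Cen)
  obtain ⟨v, hvC, hvM, hvZ⟩ := t.exists_cen' hG m hZM hne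
  obtain ⟨Q, hZQ, hQ, hQr⟩ := exists_line (Y := Z) (X := t.Cen ⊓ M) (le_inf t.le_Cen hZM)
    (fun e => hvZ (by rw [e]; exact ⟨hvC, hvM⟩))
  have hQC := hQ.trans inf_le_left
  have hQM := hQ.trans inf_le_right
  have q := t.sysZ hZQ hQC
  have hMq : M ≤ q.Cen := q.cod1' hG m hQM (by omega)
  have hMQ : ∀ u ∈ M, f (φ₁ u - φ₀ u) ∈ Q := fun u hu =>
    q.factF (hMq hu) ((h₀ u (m.le hu)).mono le_rfl hZQ) ((h₁ u hu).mono le_rfl hZQ)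
  have hQZ : ∀ u ∈ Q, f (φ₁ u - φ₀ u) ∈ Z := fun u hu =>
    t.factF (hQC hu) (h₀ u (q.le hu)) (h₁ u (hQM hu))
  by_cases hP : P ≤ DCI.Fx f t.cl Q Z
  · exact absurd (hMq.trans (t.topM q hP)) hMC
  have m' := t.Fx q
  have hQM' : Q ≤ DCI.Fx f t.cl Q Z := hQC.trans t.Cen_le_Fx
  have hlt : finrank (ZMod p) (DCI.Fx f t.cl Q Z) < finrank (ZMod p) P :=
    Submodule.finrank_lt_finrank_of_lt (lt_of_le_of_ne m'.le (fun e => hP e.ge))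
  have key : ∀ l : V →ₗ[ZMod p] V, (∀ u, f (l u) ∈ Q) → (∀ u ∈ M, l u = φ₁ u - φ₀ u) →
      (∀ u ∈ DCI.Fx f t.cl Q Z, u ∉ M → f (l u) ∈ Z) →
      ∃ φ : V →ₗ[ZMod p] V, (∀ u ∈ P, Good f P Z φ u) ∧ ∀ u ∈ M, f (φ₁ u - φ u) ∈ Z := by
    intro l l1 l2 l3
    have e : ∀ u ∈ M, φ₁ u = (φ₀ + l) u := fun u hu => by
      rw [LinearMap.add_apply, l2 u hu]; abel
    refine ⟨φ₀ + l, fun u hu => ?_, fun u hu => ?_⟩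
    · by_cases hM : u ∈ M
      · obtain ⟨k, hk, hk'⟩ := h₁ u hM
        exact ⟨k, hk, by rwa [← e u hM]⟩
      by_cases hM' : u ∈ DCI.Fx f t.cl Q Z
      · exact t.good_shift' hu (h₀ u hu) (by simpa using l3 u hM' hM)
      · apply t.good_of_fill hQC hu (t.fill hQC hZQ hQr.le hu hM')
        exact q.good_shift' hu ((h₀ u hu).mono le_rfl hZQ) (by simpa using l1 u)
    · rw [← e u hu]; simpa [t.cl.zero] using Z.zero_mem
  obtain ⟨QW, hQW⟩ := q.clY.pull
  have hμ : ∀ u ∈ M, (φ₁ - φ₀) u ∈ QW := fun u hu => by rw [hQW]; exact hMQ u hu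
  by_cases hMM : DCI.Fx f t.cl Q Z ≤ M
  · obtain ⟨l, hl, hl'⟩ := exists_ext QW (φ₁ - φ₀) hμ
    exact key l (fun u => (hQW _).1 (hl u)) hl' (fun u h h' => absurd (hMM h) h')
  obtain ⟨e, he, heM⟩ := SetLike.not_le_iff_exists.1 hMM
  obtain ⟨l, hl, hl', hle⟩ := exists_ext0 QW (φ₁ - φ₀) hμ heM
  refine key l (fun u => (hQW _).1 (hl u)) hl' (fun u h _ => ?_)
  obtain ⟨n, x, hx, rfl⟩ := decomp hQM' (by omega) he (fun h => heM (hQM h)) h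
  rw [map_add, map_nsmul, hle, smul_zero, add_zero, hl' x (hQM hx)]
  exact hQZ x hx

theorem Sys.caseOne (hG : IsPGroup p (GG f (⊤ : Submodule (ZMod p) V))) (s : Sys f Y P)
    (hfr : finrank (ZMod p) P ≤ finrank (ZMod p) Y + 4) (hYZ : Y ≤ Z) (hZ : Z ≤ s.Cen)
    (hZr : finrank (ZMod p) Z = finrank (ZMod p) Y + 1)
    (hM : ¬ P ≤ DCI.Fx f s.cl Z Y) : TG f Y P := by
  have t := s.sysZ hYZ hZ
  have m := s.Fx t
  have hlt : finrank (ZMod p) (DCI.Fx f s.cl Z Y) < finrank (ZMod p) P :=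
    Submodule.finrank_lt_finrank_of_lt (lt_of_le_of_ne m.le (fun e => hM e.ge))
  obtain ⟨φ₁, h₁⟩ := (s.sub m s.le_Fx).T3 hG (by omega)
  obtain ⟨φ₀, h₀⟩ := t.T3 hG (by omega)
  have hZM : Z ≤ DCI.Fx f s.cl Z Y := hZ.trans s.Cen_le_Fx
  have hex : ∃ φ : V →ₗ[ZMod p] V, (∀ u ∈ P, Good f P Z φ u) ∧
      ∀ u ∈ DCI.Fx f s.cl Z Y, f (φ₁ u - φ u) ∈ Z := by
    by_cases hr : finrank (ZMod p) (DCI.Fx f s.cl Z Y) ≤ finrank (ZMod p) Z + 1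
    · exact ⟨φ₀, h₀, fun u hu => t.factF (t.cod1' hG m hZM hr hu) (h₀ u (m.le hu))
        ((h₁ u hu).mono m.le hYZ)⟩
    · exact t.ext4 hG m hZM (by omega) (by omega) φ₀ φ₁ h₀
        (fun u hu => (h₁ u hu).mono m.le hYZ)
  obtain ⟨φ, hφ, hφ'⟩ := hex
  exact s.glue hYZ hZ (fun u hu hu' => s.fill hZ hYZ hZr.le hu hu') φ φ₁ hφ
    (fun u hu => (h₁ u hu).mono m.le le_rfl) hφ'

end fin4

end DCI

namespace DCI

variable {p : ℕ} [Fact p.Prime] {V : Type*} [AddCommGroup V] [Module (ZMod p) V]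
variable {f : Equiv.Perm V} {Y Z P M : Submodule (ZMod p) V}
open Module

theorem Sys.Cen_le_FxD (s : Sys f Y P) {D : Submodule (ZMod p) V} (hYD : Y ≤ D) :
    s.Cen ≤ DCI.Fx f s.cl s.Cen D := fun _ hx =>
  (mem_Fx s.cl).2 ⟨s.Cen_le hx, fun h hh _ => hYD ((s.mem_Cen.1 hx).2 h hh)⟩

theorem Sys.mem_FxD (s : Sys f Y P) {u : V} (hu : u ∈ P) :
    u ∈ DCI.Fx f s.cl s.Cen (s.D le_rfl s.le_Cen u hu) :=
  (mem_Fx s.cl).2 ⟨hu, fun _ hh hhX => s.sub_mem_D hh hhX⟩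

theorem Sys.beta_mem (s : Sys f Y P) (hall : ∀ h ∈ Hs f P, ∀ x ∈ P, h x - x ∈ s.Cen)
    {D : Submodule (ZMod p) V} {u v : V} (hv : v ∈ P) (hu : u ∈ DCI.Fx f s.cl s.Cen D) :
    f (f.symm v + f.symm u) - v - u ∈ D := by
  have h0 : f.symm 0 = 0 := by rw [Equiv.symm_apply_eq, s.cl.zero]
  have hfv : f (f.symm v) ∈ P := by simpa using hv
  have hk := s.cl.delta (om_mem hfv) P.zero_mem
  have h1 := ((mem_Fx s.cl).1 hu).2 _ hk (hall _ hk)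
  simp only [Equiv.Perm.mul_apply, tr_apply, om_apply, zero_add, h0, add_zero,
        Equiv.apply_symm_apply] at h1
  convert h1 using 1; abel

theorem Sys.line1 (s : Sys f Y P) (hall : ∀ h ∈ Hs f P, ∀ x ∈ P, h x - x ∈ s.Cen)
    {D : Submodule (ZMod p) V} {v : V} (hYD : Y ≤ D) (hD : D ≤ s.Cen)
    (hv : v ∈ DCI.Fx f s.cl s.Cen D) (n : ℕ) :
    f (n • f.symm v) - n • v ∈ D ∧ f (n • f.symm v) ∈ DCI.Fx f s.cl s.Cen D := by
  have key : f (n • f.symm v) - n • v ∈ D → f (n • f.symm v) ∈ DCI.Fx f s.cl s.Cen D := by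
    intro h
    have := Submodule.add_mem _ ((hD.trans (s.Cen_le_FxD hYD)) h) (Submodule.smul_of_tower_mem _ n hv)
    simpa using this
  suffices h : f (n • f.symm v) - n • v ∈ D from ⟨h, key h⟩
  clear key
  induction n with
  | zero => simp [s.cl.zero]
  | succ n ih =>
    have h1 : f (n • f.symm v) ∈ P := by
      simpa using P.add_mem (s.Cen_le (hD ih)) (P.smul_of_tower_mem n hv.1)
    have h2 := s.beta_mem hall h1 hv
    rw [Equiv.symm_apply_apply] at h2
    rw [succ_nsmul, succ_nsmul]
    convert D.add_mem h2 ih using 1; abel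

theorem Sys.beta_inf (s : Sys f Y P) (hall : ∀ h ∈ Hs f P, ∀ x ∈ P, h x - x ∈ s.Cen)
    {D E : Submodule (ZMod p) V} {u v : V} (hDE : D ⊓ E ≤ Y) (hv : v ∈ DCI.Fx f s.cl s.Cen D)
    (hu : u ∈ DCI.Fx f s.cl s.Cen E) : f (f.symm v + f.symm u) - v - u ∈ Y := by
  apply hDE
  refine ⟨?_, s.beta_mem hall hv.1 hu⟩
  have := s.beta_mem hall hu.1 hv
  rw [add_comm, sub_right_comm]
  exact this

theorem Sys.line2 (s : Sys f Y P) (hall : ∀ h ∈ Hs f P, ∀ x ∈ P, h x - x ∈ s.Cen)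
    {D E F : Submodule (ZMod p) V} {e v : V} (hYD : Y ≤ D) (hD : D ≤ s.Cen) (hYF : Y ≤ F)
    (hDE : D ⊓ E ≤ Y) (hDF : D ⊓ F ≤ Y) (hv : v ∈ DCI.Fx f s.cl s.Cen D)
    (he : e ∈ DCI.Fx f s.cl s.Cen E) (hve : v + e ∈ DCI.Fx f s.cl s.Cen F) (n : ℕ) :
    f (n • f.symm v) - n • v ∈ Y := by
  induction n with
  | zero => simp [s.cl.zero]
  | succ n ih =>
    have h1 := s.beta_inf hall hDE hv he
    have hy : f (f.symm v + f.symm e) ∈ DCI.Fx f s.cl s.Cen F := by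
      have := Submodule.add_mem _ ((s.le_Cen.trans (s.Cen_le_FxD hYF)) h1) hve
      rwa [sub_sub, sub_add_cancel] at this
    have h2 := s.beta_inf hall hDE (s.line1 hall hYD hD hv (n + 1)).2 he
    have h3 := s.beta_inf hall hDF (s.line1 hall hYD hD hv n).2 hy
    rw [Equiv.symm_apply_apply] at h2 h3
    rw [Equiv.symm_apply_apply, ← add_assoc, ← succ_nsmul] at h3
    rw [succ_nsmul v n]
    convert Y.add_mem (Y.add_mem (Y.sub_mem h3 h2) h1) ih using 1
    abel

section fin5

variable [Finite V]

theorem Sys.fillD (s : Sys f Y P) {u : V} (hu : u ∈ P)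
    (h : s.D le_rfl s.le_Cen u hu = s.Cen) : Fill f P s.Cen Y u := by
  intro z hz
  rw [← h] at hz
  obtain ⟨_, h, hh, _, h3⟩ := hz
  exact ⟨h, hh, h3⟩

theorem Sys.full (hG : IsPGroup p (GG f (⊤ : Submodule (ZMod p) V))) (s : Sys f Y P)
    (hX : finrank (ZMod p) s.Cen = finrank (ZMod p) Y + 2)
    (hP : finrank (ZMod p) P = finrank (ZMod p) s.Cen + 2)
    (hA : ∀ Z, Y ≤ Z → Z ≤ s.Cen → finrank (ZMod p) Z = finrank (ZMod p) Y + 1 →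
      P ≤ DCI.Fx f s.cl Z Y) {D : Submodule (ZMod p) V} (hYD : Y ≤ D) (hD : D ≤ s.Cen)
    {u v : V} (hu : u ∈ DCI.Fx f s.cl s.Cen D) (hv : v ∈ DCI.Fx f s.cl s.Cen D)
    (hu' : u ∉ s.Cen) (hv' : ∀ n : ℕ, v - n • u ∉ s.Cen) : D = s.Cen := by
  by_contra hne
  have hlt := Submodule.finrank_lt_finrank_of_lt (lt_of_le_of_ne hD hne)
  have hFP : DCI.Fx f s.cl s.Cen D ≤ P := fun _ h => h.1
  have hF : P ≤ DCI.Fx f s.cl s.Cen D := by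
    by_contra hn
    have := Submodule.finrank_lt_finrank_of_lt (lt_of_le_of_ne hFP (fun e => hn e.ge))
    obtain ⟨n, x, hx, rfl⟩ := decomp (s.Cen_le_FxD hYD) (by omega) hu hu' hv
    exact hv' n (by simpa using hx)
  have t := s.sysZ s.le_Cen le_rfl
  have hFY : P ≤ DCI.Fx f s.cl s.Cen Y := by
    intro x hx
    refine (mem_Fx s.cl).2 ⟨hx, fun h hh hhX => ?_⟩
    have h1 : ∀ x ∈ P, h x - x ∈ D := fun x hx => ((mem_Fx s.cl).1 (hF hx)).2 h hh hhX
    by_cases hYe : Y = D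
    · rw [hYe]; exact h1 x hx
    · have := Submodule.finrank_lt_finrank_of_lt (lt_of_le_of_ne hYD hYe)
      exact ((mem_Fx s.cl).1 (hA D hYD hD (by omega) hx)).2 h hh h1
  obtain ⟨c, hc, hc'⟩ := t.exists_cen hG (fun e => by
    have := congrArg (fun Q : Submodule (ZMod p) V => finrank (ZMod p) Q) e
    omega)
  exact hc' (s.topM t hFY hc)

theorem Sys.full_inf (hG : IsPGroup p (GG f (⊤ : Submodule (ZMod p) V))) (s : Sys f Y P)
    (hX : finrank (ZMod p) s.Cen = finrank (ZMod p) Y + 2)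
    (hP : finrank (ZMod p) P = finrank (ZMod p) s.Cen + 2)
    (hA : ∀ Z, Y ≤ Z → Z ≤ s.Cen → finrank (ZMod p) Z = finrank (ZMod p) Y + 1 →
      P ≤ DCI.Fx f s.cl Z Y) {D E : Submodule (ZMod p) V} (hYD : Y ≤ D) (hD : D ≤ s.Cen)
    (hYE : Y ≤ E) (hE : E ≤ s.Cen) (hDX : D ≠ s.Cen) (hEX : E ≠ s.Cen)
    {u v : V} (hu : u ∈ DCI.Fx f s.cl s.Cen D) (hv : v ∈ DCI.Fx f s.cl s.Cen E)
    (hu' : u ∉ s.Cen) (hv' : ∀ n : ℕ, v - n • u ∉ s.Cen) : D ⊓ E ≤ Y := by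
  have mono : ∀ {D D' : Submodule (ZMod p) V}, D ≤ D' →
      DCI.Fx f s.cl s.Cen D ≤ DCI.Fx f s.cl s.Cen D' := fun h x hx =>
    (mem_Fx s.cl).2 ⟨hx.1, fun k hk hk' => h (((mem_Fx s.cl).1 hx).2 k hk hk')⟩
  have h1 := s.full hG hX hP hA (hYD.trans le_sup_left) (sup_le hD hE)
    (mono le_sup_left hu) (mono le_sup_right hv) hu' hv'
  have h2 := Submodule.finrank_sup_add_finrank_inf_eq D E
  rw [h1] at h2
  have h3 := Submodule.finrank_lt_finrank_of_lt (lt_of_le_of_ne hD hDX)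
  have h4 := Submodule.finrank_lt_finrank_of_lt (lt_of_le_of_ne hE hEX)
  exact (Submodule.eq_of_le_of_finrank_le (le_inf hYD hYE) (by omega)).ge

theorem Sys.caseB (hG : IsPGroup p (GG f (⊤ : Submodule (ZMod p) V))) (s : Sys f Y P)
    (hX : finrank (ZMod p) s.Cen = finrank (ZMod p) Y + 2)
    (hP : finrank (ZMod p) P = finrank (ZMod p) s.Cen + 2)
    (hA : ∀ Z, Y ≤ Z → Z ≤ s.Cen → finrank (ZMod p) Z = finrank (ZMod p) Y + 1 →
      P ≤ DCI.Fx f s.cl Z Y) (t : Sys f s.Cen P) (hB : P ≠ t.Cen) : TG f Y P := by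
  have r := t.sysZ t.le_Cen le_rfl
  have hr := (t.Cen_finrank hG).resolve_left hB
  have hlt := Submodule.finrank_lt_finrank_of_lt (lt_of_le_of_ne t.Cen_le hB.symm)
  have hPr := r.cod1 hG (by omega)
  obtain ⟨φ₀, h₀⟩ := t.T2 hG hP.le
  obtain ⟨φ₁, h₁⟩ := (s.sub r (s.le_Cen.trans t.le_Cen)).T3 hG (by omega)
  refine s.glue s.le_Cen le_rfl (fun u hu hu' => s.fillD hu ?_) φ₀ φ₁ h₀
    (fun u hu => (h₁ u hu).mono t.Cen_le le_rfl)
    (fun u hu => t.factF hu (h₀ u (t.Cen_le hu)) ((h₁ u hu).mono t.Cen_le s.le_Cen))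
  have hex : ∃ h ∈ Hs f P, h u - u ∉ s.Cen := by
    by_contra hn
    push Not at hn
    exact hu' (t.mem_Cen.2 ⟨hu, hn⟩)
  obtain ⟨h, hh, hhu⟩ := hex
  refine s.full hG hX hP hA s.le_D s.D_le (s.mem_FxD hu) (v := h u) ?_
    (fun h => hu' (t.le_Cen h)) ?_
  · refine (mem_Fx s.cl).2 ⟨s.cl.presH hh hu, fun k hk hkX => ?_⟩
    have hk' : h⁻¹ * k * h ∈ Hs f P := mul_mem (mul_mem (inv_mem hh) hk) hh
    have hkX' : ∀ x ∈ P, (h⁻¹ * k * h) x - x ∈ s.Cen := by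
      intro x hx
      have := t.block' (mem_Hs.1 (inv_mem hh)).1 (s.cl.presH hh hx) (hkX _ (s.cl.presH hh hx))
      simpa using this
    have h1 := s.sub_mem_D (hZ := le_rfl) (hYZ := s.le_Cen) (hu := hu) hk' hkX'
    have h2 := s.cen_add (s.D_le h1) hu (mem_Hs.1 hh).1
    have h3 := Submodule.add_mem _ (s.le_D (hZ := le_rfl) (hYZ := s.le_Cen) (hu := hu) h2) h1
    simpa using h3
  · intro n hn
    have h1 : h u - u ∈ t.Cen := (r.mem_Cen.1 (hPr hu)).2 h hh
    have h2 : ((n : ZMod p) - 1) • u ∈ t.Cen := by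
      have := t.Cen.sub_mem h1 (t.le_Cen hn)
      rw [sub_smul, one_smul, Nat.cast_smul_eq_nsmul]
      convert this using 1; abel
    have h3 : (n : ZMod p) - 1 = 0 := by
      by_contra h3
      exact hu' ((t.Cen.smul_mem_iff h3).1 h2)
    rw [← Nat.cast_smul_eq_nsmul (ZMod p), sub_eq_zero.1 h3, one_smul] at hn
    exact hhu hn

end fin5

end DCI

namespace DCI

variable {p : ℕ} [Fact p.Prime] {V : Type*} [AddCommGroup V] [Module (ZMod p) V]
variable {f : Equiv.Perm V} {Y Z P M : Submodule (ZMod p) V}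
open Module

section fin6

variable [Finite V]

theorem Sys.caseA1 (hG : IsPGroup p (GG f (⊤ : Submodule (ZMod p) V))) (s : Sys f Y P)
    (hX : finrank (ZMod p) s.Cen = finrank (ZMod p) Y + 2)
    (hP : finrank (ZMod p) P = finrank (ZMod p) s.Cen + 2)
    (t : Sys f s.Cen P) (hB : P = t.Cen) (hXM : s.Cen ≤ M) (hMP : M ≤ P)
    (hMr : finrank (ZMod p) M ≤ finrank (ZMod p) s.Cen + 1)
    (hM : ∀ u, ∀ hu : u ∈ P, u ∉ M → s.D le_rfl s.le_Cen u hu = s.Cen) : TG f Y P := by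
  have r := t.sysZ hXM (hMP.trans hB.le)
  obtain ⟨φ₀, h₀⟩ := t.T2 hG hP.le
  obtain ⟨φ₁, h₁⟩ := (s.sub r (s.le_Cen.trans hXM)).T3 hG (by omega)
  exact s.glue s.le_Cen le_rfl (fun u hu hu' => s.fillD hu (hM u hu hu')) φ₀ φ₁ h₀
    (fun u hu => (h₁ u hu).mono hMP le_rfl)
    (fun u hu => t.factF (hB.le (hMP hu)) (h₀ u (hMP hu)) ((h₁ u hu).mono hMP s.le_Cen))

theorem Sys.caseA (hG : IsPGroup p (GG f (⊤ : Submodule (ZMod p) V))) (s : Sys f Y P)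
    (hX : finrank (ZMod p) s.Cen = finrank (ZMod p) Y + 2)
    (hP : finrank (ZMod p) P = finrank (ZMod p) s.Cen + 2)
    (hA : ∀ Z, Y ≤ Z → Z ≤ s.Cen → finrank (ZMod p) Z = finrank (ZMod p) Y + 1 →
      P ≤ DCI.Fx f s.cl Z Y) (t : Sys f s.Cen P) (hB : P = t.Cen) : TG f Y P := by
  have hall : ∀ h ∈ Hs f P, ∀ x ∈ P, h x - x ∈ s.Cen := fun h hh x hx =>
    (t.mem_Cen.1 (hB.le hx)).2 h hh
  by_cases hno : ∀ u, ∀ hu : u ∈ P, u ∉ s.Cen → s.D le_rfl s.le_Cen u hu = s.Cen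
  · exact s.caseA1 hG hX hP t hB le_rfl s.Cen_le (by omega) hno
  push Not at hno
  obtain ⟨u3, hu3, hu3X, hD3⟩ := hno
  obtain ⟨M, hM⟩ : ∃ M, M = s.Cen ⊔ Submodule.span (ZMod p) {u3} := ⟨_, rfl⟩
  have hu3M : u3 ∈ M := by
    rw [hM]; exact Submodule.mem_sup_right (Submodule.mem_span_singleton_self _)
  have hXM : s.Cen ≤ M := by rw [hM]; exact le_sup_left
  have hMP : M ≤ P := by rw [hM]; exact sup_le s.Cen_le (by simpa using hu3)
  have hMr : finrank (ZMod p) M = finrank (ZMod p) s.Cen + 1 := by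
    have h1 := Submodule.finrank_lt_finrank_of_lt (lt_of_le_of_ne hXM (fun e => hu3X (by
      rw [e]; exact hu3M)))
    have h2 := Submodule.finrank_add_le_finrank_add_finrank s.Cen (Submodule.span (ZMod p) {u3})
    have h3 := finrank_span_le_card (R := ZMod p) ({u3} : Set V)
    rw [← hM] at h2
    simp at h3
    omega
  by_cases hno : ∀ u, ∀ hu : u ∈ P, u ∉ M → s.D le_rfl s.le_Cen u hu = s.Cen
  · exact s.caseA1 hG hX hP t hB hXM hMP hMr.le hno
  push Not at hno
  obtain ⟨u4, hu4, hu4M, hD4⟩ := hno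
  have hu4X : u4 ∉ s.Cen := fun h => hu4M (hXM h)
  have hF3 := s.mem_FxD hu3
  have hF4 := s.mem_FxD hu4
  set D3 := s.D le_rfl s.le_Cen u3 hu3 with hD3d
  set D4 := s.D le_rfl s.le_Cen u4 hu4 with hD4d
  have hY3 : Y ≤ D3 := s.le_D
  have hY4 : Y ≤ D4 := s.le_D
  have h3X : D3 ≤ s.Cen := s.D_le
  have h4X : D4 ≤ s.Cen := s.D_le
  have h34 : D3 ⊓ D4 ≤ Y := by
    refine s.full_inf hG hX hP hA hY3 h3X hY4 h4X hD3 hD4 hF3 hF4 hu3X (fun n hn => hu4M ?_)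
    simpa using M.add_mem (hXM hn) (M.smul_of_tower_mem n hu3M)
  obtain ⟨φX, hφX⟩ := s.lin
  obtain ⟨φ', hφ'1, hφ'2⟩ := LinearMap.exists_extend_of_notMem (φX.comp s.Cen.subtype) hu3X
    (f.symm u3)
  have hφ'x : ∀ x ∈ s.Cen, φ' x = φX x := fun x hx => LinearMap.congr_fun hφ'1 ⟨x, hx⟩
  obtain ⟨φ, hφ1, hφ2⟩ := LinearMap.exists_extend_of_notMem (φ'.comp M.subtype) hu4M
    (f.symm u4)
  have hφx : ∀ x ∈ M, φ x = φ' x := fun x hx => LinearMap.congr_fun hφ1 ⟨x, hx⟩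
  refine ⟨φ, fun u hu => ?_⟩
  obtain ⟨j, y, hy, huy⟩ := decomp hMP (by omega) hu4 hu4M hu
  obtain ⟨i, x, hx, hyx⟩ := decomp hXM hMr.le hu3M hu3X hy
  obtain ⟨a, ha⟩ : ∃ a, a = f (i • f.symm u3) := ⟨_, rfl⟩
  obtain ⟨b, hb⟩ : ∃ b, b = f (j • f.symm u4) := ⟨_, rfl⟩
  have l3 := s.line1 hall hY3 h3X hF3 i
  have l4 := s.line1 hall hY4 h4X hF4 j
  rw [← ha] at l3
  rw [← hb] at l4
  have hab := s.beta_inf hall h34 l3.2 l4.2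
  have e1 : f (φ u) - x - a - b ∈ Y := by
    have h7 : f (φX x) ∈ s.Cen := by simpa using s.Cen.add_mem (s.le_Cen (hφX x hx)) hx
    have hw : f (f.symm a + f.symm b) ∈ P := by
      have := P.add_mem (P.add_mem (s.le hab) l3.2.1) l4.2.1
      convert this using 1; abel
    have h8 := s.cen_f hw h7
    have e : φ u = f.symm a + f.symm b + φX x := by
      rw [ha, hb, Equiv.symm_apply_apply, Equiv.symm_apply_apply, huy, map_add, map_nsmul, hφ2,
        hφx y hy, hyx, map_add, map_nsmul, hφ'2, hφ'x x hx]
      abel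
    rw [e]
    convert Y.add_mem (Y.add_mem h8 (hφX x hx)) hab using 1
    abel
  have eu : u = x + i • u3 + j • u4 := by rw [huy, hyx]
  set D5 := s.D le_rfl s.le_Cen u hu with hD5d
  have hY5 : Y ≤ D5 := s.le_D
  have h5X : D5 ≤ s.Cen := s.D_le
  have hF5 : u ∈ DCI.Fx f s.cl s.Cen D5 := s.mem_FxD hu
  suffices hfin : f (φ u) - u ∈ D5 by
    obtain ⟨_, h, hh, _, h9⟩ := hfin
    refine ⟨h, hh, ?_⟩
    convert Y.neg_mem h9 using 1; abel
  by_cases h5 : D5 = s.Cen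
  · rw [h5]
    convert s.Cen.add_mem (s.Cen.add_mem (s.le_Cen e1) (h3X l3.1)) (h4X l4.1) using 1
    rw [eu]; abel
  suffices hfin : a - i • u3 ∈ D5 ∧ b - j • u4 ∈ D5 by
    convert D5.add_mem (D5.add_mem (hY5 e1) hfin.1) hfin.2 using 1
    rw [eu]; abel
  have sm : ∀ (n : ℕ) (v : V), n • v = (n : ZMod p) • v := fun n v =>
    (Nat.cast_smul_eq_nsmul (ZMod p) n v).symm
  have hF5' : (i : ZMod p) • u3 + (j : ZMod p) • u4 ∈ DCI.Fx f s.cl s.Cen D5 := by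
    have := Submodule.sub_mem _ hF5 (s.Cen_le_FxD hY5 hx)
    rw [eu] at this
    rw [← sm, ← sm]
    convert this using 1; abel
  have mono : ∀ {v : V} (hv : v ∈ P), v ∈ DCI.Fx f s.cl s.Cen D5 →
      s.D le_rfl s.le_Cen v hv ≤ D5 := by
    rintro v hv hvF z ⟨_, h, hh, hhX, hz⟩
    have := D5.sub_mem (((mem_Fx s.cl).1 hvF).2 h hh hhX) (hY5 hz)
    simpa using this
  by_cases hi : (i : ZMod p) = 0
  · have e3 : a - i • u3 ∈ D5 := by rw [ha, sm, sm, hi]; simp [s.cl.zero]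
    refine ⟨e3, ?_⟩
    by_cases hj : (j : ZMod p) = 0
    · rw [hb, sm, sm, hj]; simp [s.cl.zero]
    · rw [hi, zero_smul, zero_add] at hF5'
      exact mono hu4 ((Submodule.smul_mem_iff _ hj).1 hF5') l4.1
  by_cases hj : (j : ZMod p) = 0
  · have e4 : b - j • u4 ∈ D5 := by rw [hb, sm, sm, hj]; simp [s.cl.zero]
    refine ⟨?_, e4⟩
    rw [hj, zero_smul, add_zero] at hF5'
    exact mono hu3 ((Submodule.smul_mem_iff _ hi).1 hF5') l3.1
  have h35 : D3 ⊓ D5 ≤ Y := by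
    refine s.full_inf hG hX hP hA hY3 h3X hY5 h5X hD3 h5 hF3 hF5 hu3X (fun n hn => hu4M ?_)
    rw [← M.smul_mem_iff hj, ← sm]
    have := M.sub_mem (M.add_mem (hXM hn) (M.smul_of_tower_mem n hu3M)) hy
    convert this using 1
    rw [huy]; abel
  have h45 : D4 ⊓ D5 ≤ Y := by
    refine s.full_inf hG hX hP hA hY4 h4X hY5 h5X hD4 h5 hF4 hF5 hu4X (fun n hn => ?_)
    have h1 : ((j : ZMod p) - n) • u4 ∈ M := by
      have := M.sub_mem (hXM hn) hy
      rw [sub_smul, ← sm, ← sm]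
      convert this using 1
      rw [huy]; abel
    have h2 : (j : ZMod p) - n = 0 := by
      by_contra h2
      exact hu4M ((M.smul_mem_iff h2).1 h1)
    rw [sm n, ← sub_eq_zero.1 h2, ← sm] at hn
    apply hu3X
    rw [← s.Cen.smul_mem_iff hi, ← sm]
    have := s.Cen.sub_mem hn hx
    convert this using 1
    rw [eu]; abel
  constructor
  · apply hY5
    rw [ha]
    refine s.line2 hall hY3 h3X hY5 h34 h35 hF3
      (Submodule.smul_mem _ ((i : ZMod p)⁻¹ * j) hF4) ?_ i
    have := Submodule.smul_mem _ (i : ZMod p)⁻¹ hF5'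
    rwa [smul_add, smul_smul, smul_smul, inv_mul_cancel₀ hi, one_smul] at this
  · apply hY5
    rw [hb]
    refine s.line2 hall hY4 h4X hY5 (by rwa [inf_comm]) h45 hF4
      (Submodule.smul_mem _ ((j : ZMod p)⁻¹ * i) hF3) ?_ j
    have := Submodule.smul_mem _ (j : ZMod p)⁻¹ hF5'
    rwa [smul_add, smul_smul, smul_smul, inv_mul_cancel₀ hj, one_smul, add_comm] at this

theorem Sys.T4 (hG : IsPGroup p (GG f (⊤ : Submodule (ZMod p) V))) (s : Sys f Y P)
    (hfr : finrank (ZMod p) P ≤ finrank (ZMod p) Y + 4) : TG f Y P := by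
  by_cases hA : ∀ Z, Y ≤ Z → Z ≤ s.Cen → finrank (ZMod p) Z = finrank (ZMod p) Y + 1 →
      P ≤ DCI.Fx f s.cl Z Y
  · by_cases hYP : Y = s.Cen
    · apply s.T3 hG
      rcases s.Cen_finrank hG with h | h
      · rw [h, ← hYP]; omega
      · rw [← hYP] at h; omega
    obtain ⟨Z, hYZ, hZ, hZr⟩ := exists_line s.le_Cen hYP
    by_cases hc : finrank (ZMod p) P ≤ finrank (ZMod p) s.Cen + 1
    · exact s.codim hG hc
    have t := s.sysZ s.le_Cen le_rfl
    rcases s.bigCen hG (s.sysZ hYZ hZ) (hA Z hYZ hZ hZr) with h | h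
    · rw [← h] at hc; omega
    by_cases hB : P = t.Cen
    · exact s.caseA hG (by omega) (by omega) hA t hB
    · exact s.caseB hG (by omega) (by omega) hA t hB
  · push Not at hA
    obtain ⟨Z, h1, h2, h3, h4⟩ := hA
    exact s.caseOne hG hfr h1 h2 h3 h4

end fin6

end DCI

namespace DCI

variable {p : ℕ} [Fact p.Prime] {V : Type*} [AddCommGroup V] [Module (ZMod p) V]
open Module

section final

/-- automorphisms of the Cayley digraph -/
def AutS (S : Set V) : Subgroup (Equiv.Perm V) where
  carrier := {g | ∀ x y, -x + y ∈ S ↔ -(g x) + g y ∈ S}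
  one_mem' := fun x y => Iff.rfl
  mul_mem' := by
    intro a b ha hb x y
    exact (hb x y).trans (ha _ _)
  inv_mem' := by
    intro a ha x y
    have := ha (a⁻¹ x) (a⁻¹ y)
    simpa using this.symm

theorem isPGroup_mult : IsPGroup p (Multiplicative V) := by
  intro g
  refine ⟨1, ?_⟩
  apply Multiplicative.toAdd.injective
  rw [toAdd_pow, pow_one, toAdd_one, ← Nat.cast_smul_eq_nsmul (ZMod p)]
  simp

theorem final [Finite V] (hfr : finrank (ZMod p) V ≤ 4) (S T : Set V) (f : Equiv.Perm V)
    (hf : ∀ x y : V, -x + y ∈ S ↔ -(f x) + f y ∈ T) : ∃ φ : V ≃+ V, ⇑φ '' S = T := by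
  let tA : Multiplicative V →* AutS S :=
    { toFun := fun v => ⟨tr v.toAdd, fun x y => by simp [tr_apply]⟩
      map_one' := by ext x; simp
      map_mul' := by intro a b; ext x; simp [add_assoc] }
  let wA : Multiplicative V →* AutS S :=
    { toFun := fun v => ⟨f⁻¹ * tr v.toAdd * f, fun x y => by
        rw [hf, hf]; simp⟩
      map_one' := by ext x; simp
      map_mul' := by intro a b; ext x; simp [add_assoc] }
  have h1 : IsPGroup p tA.range := isPGroup_mult.of_surjective tA.rangeRestrict
    tA.rangeRestrict_surjective
  have h2 : IsPGroup p wA.range := isPGroup_mult.of_surjective wA.rangeRestrict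
    wA.rangeRestrict_surjective
  obtain ⟨P1, hP1⟩ := h1.exists_le_sylow
  obtain ⟨P2, hP2⟩ := h2.exists_le_sylow
  obtain ⟨a, ha⟩ := MulAction.exists_smul_eq (AutS S) P2 P1
  have ht : ∀ v, tr v ∈ (P1 : Subgroup (AutS S)).map (AutS S).subtype := fun v =>
    ⟨tA (Multiplicative.ofAdd v), hP1 ⟨_, rfl⟩, rfl⟩
  have hw : ∀ v, (a : Equiv.Perm V) * (f⁻¹ * tr v * f) * (a : Equiv.Perm V)⁻¹ ∈
      (P1 : Subgroup (AutS S)).map (AutS S).subtype := fun v => by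
    refine ⟨a * wA (Multiplicative.ofAdd v) * a⁻¹, ?_, rfl⟩
    rw [← ha]
    have : wA (Multiplicative.ofAdd v) ∈ (P2 : Subgroup (AutS S)) := hP2 ⟨_, rfl⟩
    have h3 := Subgroup.smul_mem_pointwise_smul _ (MulAut.conj a) _ this
    exact h3
  have hpP : IsPGroup p ((P1 : Subgroup (AutS S)).map (AutS S).subtype) := P1.isPGroup'.map _
  have hle : (P1 : Subgroup (AutS S)).map (AutS S).subtype ≤ AutS S := by
    rintro _ ⟨x, _, rfl⟩; exact x.2
  set Q := (P1 : Subgroup (AutS S)).map (AutS S).subtype with hQ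
  obtain ⟨c, hc⟩ : ∃ c, c = -((a : Equiv.Perm V) (f⁻¹ 0)) := ⟨_, rfl⟩
  obtain ⟨F, hF⟩ : ∃ F, F = tr c * (a : Equiv.Perm V) * f⁻¹ := ⟨_, rfl⟩
  have hF0 : F 0 = 0 := by rw [hF, hc]; simp
  have hFST : ∀ x y, -x + y ∈ T ↔ -(F x) + F y ∈ S := by
    intro x y
    have e1 := hf (f⁻¹ x) (f⁻¹ y)
    have e2 := a.2 (f⁻¹ x) (f⁻¹ y)
    rw [hF]
    have e0 : ∀ z, f (f⁻¹ z) = z := fun z => f.apply_symm_apply z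
    rw [e0, e0] at e1
    rw [← e1, e2]
    simp
  have hGQ : GG F (⊤ : Submodule (ZMod p) V) ≤ Q := by
    rw [GG, Subgroup.closure_le]
    rintro g (⟨v, _, rfl⟩ | ⟨w, _, rfl⟩)
    · exact ht v
    · have : om F w = tr c * ((a : Equiv.Perm V) * (f⁻¹ * tr w * f) * (a : Equiv.Perm V)⁻¹) *
          (tr c)⁻¹ := by
        rw [om, hF]
        change _ * tr w * _ = _
        group
      rw [SetLike.mem_coe, this]
      exact Q.mul_mem (Q.mul_mem (ht c) (hw w)) (Q.inv_mem (ht c))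
  have hG : IsPGroup p (GG F (⊤ : Submodule (ZMod p) V)) := hpP.to_le hGQ
  have s : Sys F (⊥ : Submodule (ZMod p) V) ⊤ :=
    ⟨⟨hF0, fun _ _ _ _ => trivial⟩, bot_le, fun h hh y hy => by
      rw [Submodule.mem_bot] at hy ⊢
      rw [hy, (mem_Hs.1 hh).2]⟩
  obtain ⟨φ, hφ⟩ := s.T4 hG (by simpa using hfr)
  have key : ∀ u, ∃ h ∈ AutS S, h 0 = 0 ∧ F (φ u) = h u := by
    intro u
    obtain ⟨h, hh, he⟩ := hφ u trivial
    rw [Submodule.mem_bot, sub_eq_zero] at he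
    exact ⟨h, hle (hGQ (mem_Hs.1 hh).1), (mem_Hs.1 hh).2, he⟩
  have hinj : Function.Injective φ := by
    rw [injective_iff_map_eq_zero]
    intro u hu
    obtain ⟨h, _, h0, he⟩ := key u
    rw [hu, hF0] at he
    exact h.injective (he.symm.trans h0.symm)
  have hST : ∀ u, u ∈ S ↔ φ u ∈ T := by
    intro u
    obtain ⟨h, hh, h0, he⟩ := key u
    have e1 := hh 0 u
    have e2 := hFST 0 (φ u)
    rw [hF0, he] at e2
    rw [h0] at e1
    simp only [neg_zero, zero_add] at e1 e2
    rw [e1, e2]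
  refine ⟨AddEquiv.ofBijective φ (Finite.injective_iff_bijective.1 hinj), ?_⟩
  ext y
  constructor
  · rintro ⟨u, hu, rfl⟩
    exact (hST u).1 hu
  · intro hy
    obtain ⟨u, rfl⟩ := (Finite.injective_iff_bijective.1 hinj).2 y
    exact ⟨u, (hST u).2 hy, rfl⟩

end final

end DCI

/-- **Theorem 1.1.** For every prime `p`, the elementary abelian group
`R = (ℤ/pℤ)^4` is a DCI-group: for all subsets `S, T ⊆ R`, if the Cayley digraphs
`Cay(R,S)` and `Cay(R,T)` are isomorphic (via a bijection `f : R → R` with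
`-x + y ∈ S ↔ -(f x) + f y ∈ T` for all `x, y`), then there exists a group
automorphism `φ` of `R` with `φ(S) = T`. -/
theorem stmt_0 (p : ℕ) (hp : p.Prime) (S T : Set (Fin 4 → ZMod p))
    (f : Equiv.Perm (Fin 4 → ZMod p))
    (hf : ∀ x y : Fin 4 → ZMod p, -x + y ∈ S ↔ -(f x) + f y ∈ T) :
    ∃ φ : (Fin 4 → ZMod p) ≃+ (Fin 4 → ZMod p), ⇑φ '' S = T := by
  have : Fact p.Prime := ⟨hp⟩
  exact DCI.final (p := p) (by simp) S T f hf
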